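/- Let q be a power of an odd prime and let n, s be integers with 0 ≤ 2s ≤ n. Then the number of skew-symmetric n×n matrices over 𝔽_q of rank 2s equals q^{s²−s} · ∏_{i=0}^{2s−1} (q^{n−i}−1) / ∏_{i=1}^{s} (q^{2i}−1). -/

import Mathlib

open Matrix Finset

section Bordered

variable {F : Type*} [Field F] {m ι : Type*}

theorem range_mulVecLin_fromCols_replicateCol [Fintype ι] (A : Matrix m ι F) (v : m → F) :
    LinearMap.range (fromCols A (replicateCol Unit v)).mulVecLin =
      LinearMap.range A.mulVecLin ⊔ Submodule.span F {v} := by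
  rw [range_mulVecLin, range_mulVecLin, ← Submodule.span_union]
  congr 1
  ext x
  simp only [Set.mem_range, Sum.exists, Set.mem_union, Set.mem_singleton_iff]
  refine or_congr Iff.rfl ⟨fun ⟨_, h⟩ => h.symm, fun h => ⟨(), h.symm⟩⟩

theorem rank_fromCols_replicateCol_of_mem [Fintype m] [Fintype ι] (A : Matrix m ι F) {v : m → F}
    (hv : v ∈ LinearMap.range A.mulVecLin) :
    (fromCols A (replicateCol Unit v)).rank = A.rank := by
  rw [rank, rank, range_mulVecLin_fromCols_replicateCol, sup_eq_left.2]
  simpa using hv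

theorem rank_fromCols_replicateCol_of_notMem [Fintype m] [Fintype ι] (A : Matrix m ι F) {v : m → F}
    (hv : v ∉ LinearMap.range A.mulVecLin) :
    (fromCols A (replicateCol Unit v)).rank = A.rank + 1 := by
  rw [rank, rank, range_mulVecLin_fromCols_replicateCol, Submodule.finrank_sup_span_singleton hv]

/-- The skew-symmetric extension of `M` by one row and one column, with last column `v`. -/
def skewBordered (M : Matrix ι ι F) (v : ι → F) : Matrix (ι ⊕ Unit) (ι ⊕ Unit) F :=
  fromBlocks M (replicateCol Unit v) (-replicateRow Unit v) 0

theorem dotProduct_mulVec_self_of_transpose_eq_neg [Fintype ι] (h2 : (2 : F) ≠ 0) {M : Matrix ι ι F}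
    (hM : Mᵀ = -M) (w : ι → F) : M *ᵥ w ⬝ᵥ w = 0 := by
  have h : M *ᵥ w ⬝ᵥ w = -(M *ᵥ w ⬝ᵥ w) := by
    conv_lhs => rw [dotProduct_comm, dotProduct_mulVec, ← mulVec_transpose, hM, neg_mulVec,
      neg_dotProduct]
  have h' : (2 : F) * (M *ᵥ w ⬝ᵥ w) = 0 := by linear_combination h
  exact (mul_eq_zero.1 h').resolve_left h2

theorem skewBordered_eq_fromCols (M : Matrix ι ι F) (v : ι → F) :
    skewBordered M v = fromCols (fromRows M (-replicateRow Unit v))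
      (replicateCol Unit (Sum.elim v 0)) := by
  ext i j
  rcases i with i | i <;> rcases j with j | j <;> simp [skewBordered]

theorem transpose_fromRows_neg_replicateRow {M : Matrix ι ι F} (hM : Mᵀ = -M) (v : ι → F) :
    (fromRows M (-replicateRow Unit v))ᵀ = -fromCols M (replicateCol Unit v) := by
  rw [transpose_fromRows, hM, fromCols_neg]
  rfl

theorem rank_neg_eq [Fintype ι] (A : Matrix m ι F) : (-A).rank = A.rank := by
  have h : (-A).mulVecLin = -A.mulVecLin := LinearMap.ext fun w => neg_mulVec w A
  rw [rank, rank, h, LinearMap.range_neg]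

theorem rank_skewBordered_of_mem [Fintype ι] (h2 : (2 : F) ≠ 0) {M : Matrix ι ι F} (hM : Mᵀ = -M)
    {v : ι → F} (hv : v ∈ LinearMap.range M.mulVecLin) :
    (skewBordered M v).rank = M.rank := by
  rw [skewBordered_eq_fromCols, rank_fromCols_replicateCol_of_mem, ← rank_transpose,
    transpose_fromRows_neg_replicateRow hM, rank_neg_eq, rank_fromCols_replicateCol_of_mem M hv]
  obtain ⟨w, rfl⟩ := hv
  refine ⟨w, ?_⟩
  rw [mulVecLin_apply, fromRows_mulVec]
  congr 1
  ext i
  rw [neg_mulVec]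
  exact neg_eq_zero.2 (dotProduct_mulVec_self_of_transpose_eq_neg h2 hM w)

theorem rank_skewBordered_of_notMem [Fintype ι] {M : Matrix ι ι F} (hM : Mᵀ = -M)
    {v : ι → F} (hv : v ∉ LinearMap.range M.mulVecLin) :
    (skewBordered M v).rank = M.rank + 2 := by
  rw [skewBordered_eq_fromCols, rank_fromCols_replicateCol_of_notMem, ← rank_transpose,
    transpose_fromRows_neg_replicateRow hM, rank_neg_eq, rank_fromCols_replicateCol_of_notMem M hv]
  rintro ⟨w, hw⟩
  refine hv ⟨w, ?_⟩
  rw [mulVecLin_apply, fromRows_mulVec] at hw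
  exact (Sum.elim_eq_iff.1 hw).1

theorem transpose_skewBordered {M : Matrix ι ι F} (hM : Mᵀ = -M) (v : ι → F) :
    (skewBordered M v)ᵀ = -skewBordered M v := by
  rw [skewBordered, fromBlocks_transpose, fromBlocks_neg, hM]
  simp

theorem exists_eq_skewBordered (h2 : (2 : F) ≠ 0) {B : Matrix (ι ⊕ Unit) (ι ⊕ Unit) F}
    (hB : Bᵀ = -B) : ∃ M : Matrix ι ι F, Mᵀ = -M ∧ ∃ v, skewBordered M v = B := by
  have hB' : ∀ i j, B j i = -B i j := fun i j => congrFun (congrFun hB i) j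
  refine ⟨B.toBlocks₁₁, ?_, fun i => B (Sum.inl i) (Sum.inr ()), ?_⟩
  · ext i j
    exact hB' _ _
  · ext i j
    rcases i with i | i <;> rcases j with j | j
    · rfl
    · rfl
    · simp [skewBordered, hB' (Sum.inl j) (Sum.inr i)]
    · have h : (2 : F) * B (Sum.inr ()) (Sum.inr ()) = 0 := by
        linear_combination hB' (Sum.inr ()) (Sum.inr ())
      exact ((mul_eq_zero.1 h).resolve_left h2).symm

theorem skewBordered_injective2 : Function.Injective2 (skewBordered (F := F) (ι := ι)) := by
  intro M N v w h
  obtain ⟨h₁, h₂, -⟩ := fromBlocks_inj.1 h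
  exact ⟨h₁, replicateCol_injective h₂⟩

end Bordered

section Count

variable {F : Type*} [Field F] [Fintype F]

open Classical in
/-- The skew-symmetric `n × n` matrices of rank `r`. -/
noncomputable def skewOfRank (F : Type*) [Field F] [Fintype F] (n r : ℕ) :
    Finset (Matrix (Fin n) (Fin n) F) :=
  {M | Mᵀ = -M ∧ M.rank = r}

open Classical in
theorem card_skewOfRank_succ_eq_sum (h2 : (2 : F) ≠ 0) (n r : ℕ) :
    #(skewOfRank F (n + 1) r) =
      ∑ M : Matrix (Fin n) (Fin n) F with Mᵀ = -M,
        #{v : Fin n → F | (skewBordered M v).rank = r} := by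
  rw [← card_sigma]
  let e : Fin n ⊕ Unit ≃ Fin (n + 1) := Fintype.equivOfCardEq (by simp)
  symm
  refine card_bij (fun x _ => reindex e e (skewBordered x.1 x.2)) ?_ ?_ ?_
  · rintro ⟨M, v⟩ h
    simp only [mem_sigma, mem_filter, mem_univ, true_and, skewOfRank] at h ⊢
    refine ⟨?_, by rw [rank_reindex, h.2]⟩
    rw [transpose_reindex, transpose_skewBordered h.1]
    rfl
  · rintro ⟨M, v⟩ - ⟨N, w⟩ - h
    obtain ⟨rfl, rfl⟩ := skewBordered_injective2 ((reindex e e).injective h)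
    rfl
  · intro B hB
    simp only [mem_filter, mem_univ, true_and, skewOfRank] at hB
    have hB' : ((reindex e e).symm B)ᵀ = -(reindex e e).symm B := by
      rw [reindex_symm, transpose_reindex, hB.1]
      rfl
    obtain ⟨M, hM, v, hv⟩ := exists_eq_skewBordered h2 hB'
    have hv' : reindex e e (skewBordered M v) = B := by rw [hv, Equiv.apply_symm_apply]
    refine ⟨⟨M, v⟩, ?_, hv'⟩
    simp only [mem_sigma, mem_filter, mem_univ, true_and]
    exact ⟨hM, by rw [← hB.2, ← hv', rank_reindex]⟩

open Classical in
theorem card_filter_mem_range_mulVecLin {n : ℕ} (M : Matrix (Fin n) (Fin n) F) :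
    #{v | v ∈ LinearMap.range M.mulVecLin} = Fintype.card F ^ M.rank := by
  rw [rank, ← Module.card_eq_pow_finrank, Fintype.card_subtype]

open Classical in
theorem card_filter_notMem_range_mulVecLin {n : ℕ} (M : Matrix (Fin n) (Fin n) F) :
    (#{v | v ∉ LinearMap.range M.mulVecLin} : ℚ) =
      (Fintype.card F : ℚ) ^ n - (Fintype.card F : ℚ) ^ M.rank := by
  have h := card_filter_add_card_filter_not (s := (univ : Finset (Fin n → F)))
    (fun v => v ∈ LinearMap.range M.mulVecLin)
  rw [card_filter_mem_range_mulVecLin, card_univ, Fintype.card_fun, Fintype.card_fin] at h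
  rw [eq_sub_iff_add_eq']
  exact_mod_cast h

open Classical in
theorem card_filter_rank_skewBordered (h2 : (2 : F) ≠ 0) {n : ℕ} {M : Matrix (Fin n) (Fin n) F}
    (hM : Mᵀ = -M) (r : ℕ) :
    (#{v : Fin n → F | (skewBordered M v).rank = r} : ℚ) =
      (if M.rank = r then (Fintype.card F : ℚ) ^ r else 0) +
        if M.rank + 2 = r then (Fintype.card F : ℚ) ^ n - (Fintype.card F : ℚ) ^ M.rank else 0 := by
  have h : ∀ v, (skewBordered M v).rank =
      if v ∈ LinearMap.range M.mulVecLin then M.rank else M.rank + 2 := by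
    intro v
    split_ifs with hv
    · exact rank_skewBordered_of_mem h2 hM hv
    · exact rank_skewBordered_of_notMem hM hv
  simp only [h]
  by_cases h₁ : M.rank = r
  · subst h₁
    have : ∀ v, (if v ∈ LinearMap.range M.mulVecLin then M.rank else M.rank + 2) = M.rank ↔
      v ∈ LinearMap.range M.mulVecLin := by intro v; split_ifs with hv <;> simp [hv]
    simp only [this, card_filter_mem_range_mulVecLin]
    simp
  by_cases h₂ : M.rank + 2 = r
  · subst h₂
    have : ∀ v, (if v ∈ LinearMap.range M.mulVecLin then M.rank else M.rank + 2) = M.rank + 2 ↔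
      v ∉ LinearMap.range M.mulVecLin := by intro v; split_ifs with hv <;> simp [hv]
    simp only [this, card_filter_notMem_range_mulVecLin]
    simp
  · have : ∀ v, (if v ∈ LinearMap.range M.mulVecLin then M.rank else M.rank + 2) ≠ r := by
      intro v; split_ifs <;> assumption
    simp only [this, h₁, h₂, filter_false, card_empty, if_false]
    simp

theorem card_skewOfRank_succ (h2 : (2 : F) ≠ 0) (n r : ℕ) :
    (#(skewOfRank F (n + 1) (r + 2)) : ℚ) =
      (Fintype.card F : ℚ) ^ (r + 2) * #(skewOfRank F n (r + 2)) +
        ((Fintype.card F : ℚ) ^ n - (Fintype.card F : ℚ) ^ r) * #(skewOfRank F n r) := by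
  classical
  rw [card_skewOfRank_succ_eq_sum h2, Nat.cast_sum]
  rw [sum_congr rfl fun M hM => card_filter_rank_skewBordered h2 (mem_filter.1 hM).2 (r + 2),
    sum_add_distrib, ← sum_filter, ← sum_filter, filter_filter, filter_filter]
  simp only [Nat.add_right_cancel_iff]
  rw [sum_congr (s₁ := filter (fun M => Mᵀ = -M ∧ M.rank = r) univ) rfl
    fun M hM => by rw [(mem_filter.1 hM).2.2]]
  simp only [sum_const, nsmul_eq_mul, skewOfRank]
  rw [mul_comm, mul_comm (_ - _)]

theorem card_skewOfRank_zero_right (n : ℕ) : #(skewOfRank F n 0) = 1 := by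
  classical
  rw [card_eq_one]
  refine ⟨0, ?_⟩
  ext M
  simp only [skewOfRank, mem_filter, mem_univ, true_and, mem_singleton]
  refine ⟨fun h => ?_, ?_⟩
  · have := h.2
    rw [rank, Submodule.finrank_eq_zero, LinearMap.range_eq_bot] at this
    exact ext_of_mulVec_single fun i =>
      (LinearMap.congr_fun this (Pi.single i 1)).trans (zero_mulVec _).symm
  · rintro rfl
    simp

theorem card_skewOfRank_zero_left (r : ℕ) : #(skewOfRank F 0 (r + 1)) = 0 := by
  rw [card_eq_zero, skewOfRank, filter_eq_empty_iff]
  rintro M - ⟨-, h⟩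
  have := M.rank_le_width
  omega

end Count

/-- The number of skew-symmetric `n × n` matrices of rank `2 * s`, as a rational function of the
order `q` of the field. -/
def skewRankFormula (q : ℚ) (n s : ℕ) : ℚ :=
  q ^ (s ^ 2 - s) * (∏ i ∈ range (2 * s), (q ^ (n - i) - 1)) / ∏ i ∈ Icc 1 s, (q ^ (2 * i) - 1)

theorem skewRankFormula_zero_right (q : ℚ) (n : ℕ) : skewRankFormula q n 0 = 1 := by
  simp [skewRankFormula]

theorem skewRankFormula_eq_zero {q : ℚ} {n s : ℕ} (h : n < 2 * s) : skewRankFormula q n s = 0 := by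
  rw [skewRankFormula, prod_eq_zero (mem_range.2 h) (by simp)]
  simp

theorem skewRankFormula_succ {q : ℚ} (hq : 1 < q) (n s : ℕ) :
    skewRankFormula q (n + 1) (s + 1) =
      q ^ (2 * s + 2) * skewRankFormula q n (s + 1) +
        (q ^ n - q ^ (2 * s)) * skewRankFormula q n s := by
  rcases lt_or_ge n (2 * s + 1) with h | h
  · rw [skewRankFormula_eq_zero (n := n + 1) (by omega), skewRankFormula_eq_zero (s := s + 1)
      (by omega)]
    rcases eq_or_ne n (2 * s) with rfl | hn
    · simp
    · rw [skewRankFormula_eq_zero (s := s) (by omega)]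
      simp
  obtain ⟨m, rfl⟩ := Nat.exists_eq_add_of_le h
  have hne : ∀ i ∈ Icc 1 s, q ^ (2 * i) - 1 ≠ 0 := fun i hi =>
    (sub_pos.2 (one_lt_pow₀ hq (by have := (mem_Icc.1 hi).1; omega))).ne'
  have hD := prod_ne_zero_iff.2 hne
  have hs : q ^ (2 * (s + 1)) - 1 ≠ 0 := (sub_pos.2 (one_lt_pow₀ hq (by omega))).ne'
  have hexp : (s + 1) ^ 2 - (s + 1) = (s ^ 2 - s) + 2 * s := by
    have : s ≤ s ^ 2 := Nat.le_self_pow (by norm_num) s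
    have : (s + 1) ^ 2 = s ^ 2 + 2 * s + 1 := by ring
    omega
  have hl : ∏ i ∈ range (2 * (s + 1)), (q ^ (2 * s + 1 + m + 1 - i) - 1) =
      (∏ i ∈ range (2 * s), (q ^ (2 * s + 1 + m - i) - 1)) * (q ^ (m + 1) - 1) *
        (q ^ (2 * s + 1 + m + 1) - 1) := by
    rw [show 2 * (s + 1) = 2 * s + 1 + 1 by ring, prod_range_succ']
    simp only [Nat.add_sub_add_right, Nat.sub_zero]
    rw [prod_range_succ, show 2 * s + 1 + m - 2 * s = m + 1 by omega]
  have hr : ∏ i ∈ range (2 * (s + 1)), (q ^ (2 * s + 1 + m - i) - 1) =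
      (∏ i ∈ range (2 * s), (q ^ (2 * s + 1 + m - i) - 1)) * (q ^ (m + 1) - 1) * (q ^ m - 1) := by
    rw [show 2 * (s + 1) = 2 * s + 1 + 1 by ring, prod_range_succ, prod_range_succ,
      show 2 * s + 1 + m - 2 * s = m + 1 by omega, show 2 * s + 1 + m - (2 * s + 1) = m by omega]
  rw [skewRankFormula, skewRankFormula, skewRankFormula, hl, hr, hexp,
    prod_Icc_succ_top (by omega)]
  generalize ∏ i ∈ range (2 * s), (q ^ (2 * s + 1 + m - i) - 1) = P
  generalize ∏ i ∈ Icc 1 s, (q ^ (2 * i) - 1) = D at *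
  generalize s ^ 2 - s = a
  field_simp
  ring

theorem card_skewOfRank {F : Type*} [Field F] [Fintype F] (h2 : (2 : F) ≠ 0) (n s : ℕ) :
    (#(skewOfRank F n (2 * s)) : ℚ) = skewRankFormula (Fintype.card F) n s := by
  induction n generalizing s with
  | zero =>
    rcases s with _ | s
    · simp [card_skewOfRank_zero_right, skewRankFormula_zero_right]
    · rw [skewRankFormula_eq_zero (by omega), show 2 * (s + 1) = 2 * s + 1 + 1 by ring,
        card_skewOfRank_zero_left, Nat.cast_zero]
  | succ n ih =>
    rcases s with _ | s
    · simp [card_skewOfRank_zero_right, skewRankFormula_zero_right]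
    · rw [skewRankFormula_succ (by exact_mod_cast Fintype.one_lt_card), ← ih, ← ih]
      exact card_skewOfRank_succ h2 n (2 * s)

/-- the number of skew-symmetric `n×n` matrices over `𝔽_q` of rank `2s`. -/
theorem card_skewsymmetric_matrices_rank
    (p k q : ℕ) (hp : p.Prime) (hpodd : Odd p) (hk : 1 ≤ k) (hq : q = p ^ k)
    (F : Type) [Field F] [Fintype F] (hF : Fintype.card F = q)
    (n s : ℕ) (hs : 2 * s ≤ n) :
    (Nat.card {M : Matrix (Fin n) (Fin n) F | Mᵀ = -M ∧ M.rank = 2 * s} : ℚ) =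
      (q : ℚ) ^ (s ^ 2 - s) *
        (∏ i ∈ Finset.range (2 * s), ((q : ℚ) ^ (n - i) - 1)) /
          ∏ i ∈ Finset.Icc 1 s, ((q : ℚ) ^ (2 * i) - 1) := by
  classical
  have h2 : (2 : F) ≠ 0 := by
    refine Ring.two_ne_zero fun h => ?_
    have h' := FiniteField.even_card_of_char_two h
    rw [hF, hq, ← Nat.even_iff] at h'
    exact Nat.not_even_iff_odd.2 hpodd.pow h'
  have h := card_skewOfRank h2 n s
  rw [hF, skewRankFormula] at h
  rw [← h, skewOfRank, Nat.card_eq_fintype_card, Fintype.card_subtype]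
  congr!
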